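/- Let f : E → ℝ be differentiable, convex, and L-smooth with L > 0, and let θ* ∈ E be a minimizer of f. Then for all θ ∈ E, ⟨∇f(θ), θ − θ*⟩ ≥ (1/L)·‖∇f(θ)‖². -/

import Mathlib

open RealInnerProductSpace

section GradientInequalities

variable {E : Type*} [NormedAddCommGroup E] [InnerProductSpace ℝ E] [CompleteSpace E]

theorem Differentiable.hasDerivAt_comp_add_smul {f : E → ℝ} (hf : Differentiable ℝ f)
    (x v : E) (t : ℝ) :
    HasDerivAt (fun s : ℝ => f (x + s • v)) ⟪gradient f (x + t • v), v⟫ t := by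
  have hline : HasDerivAt (fun s : ℝ => x + s • v) v t := by
    simpa using ((hasDerivAt_id t).smul_const v).const_add x
  rw [inner_gradient_left]
  exact (hf (x + t • v)).hasFDerivAt.comp_hasDerivAt t hline

/-- A differentiable convex function lies above its tangent hyperplanes. -/
theorem ConvexOn.add_inner_gradient_le {f : E → ℝ} (hconv : ConvexOn ℝ Set.univ f)
    (hf : Differentiable ℝ f) (x v : E) :
    f x + ⟪gradient f x, v⟫ ≤ f (x + v) := by
  have hφ : ConvexOn ℝ Set.univ (fun s : ℝ => f (x + s • v)) := by
    have h := hconv.comp_affineMap (AffineMap.lineMap x (x + v) : ℝ →ᵃ[ℝ] E)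
    simpa [Function.comp_def, AffineMap.lineMap_apply, add_comm] using h
  have h := hφ.le_slope_of_hasDerivAt (Set.mem_univ 0) (Set.mem_univ 1) zero_lt_one
    (hf.hasDerivAt_comp_add_smul x v 0)
  simp only [slope_def_field, zero_smul, one_smul, add_zero, sub_zero, div_one] at h
  linarith

/-- The descent lemma: a function with `L`-Lipschitz gradient lies below a quadratic. -/
theorem Differentiable.le_add_inner_gradient_add_sq {f : E → ℝ} (hf : Differentiable ℝ f) {L : ℝ}
    (hsmooth : ∀ x y : E, ‖gradient f x - gradient f y‖ ≤ L * ‖x - y‖) (x v : E) :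
    f (x + v) ≤ f x + ⟪gradient f x, v⟫ + L / 2 * ‖v‖ ^ 2 := by
  have hB (t : ℝ) : HasDerivAt
      (fun s : ℝ => f x + s * ⟪gradient f x, v⟫ + L / 2 * ‖v‖ ^ 2 * s ^ 2)
      (⟪gradient f x, v⟫ + L * ‖v‖ ^ 2 * t) t := by
    have h := (((hasDerivAt_id t).mul_const ⟪gradient f x, v⟫).const_add (f x)).add
      (((hasDerivAt_id t).pow 2).const_mul (L / 2 * ‖v‖ ^ 2))
    refine (h.congr_deriv ?_).congr_of_eventuallyEq (.of_forall fun s => ?_)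
    · simp
      ring
    · simp
  have hφ := hf.hasDerivAt_comp_add_smul x v
  have h := image_le_of_deriv_right_le_deriv_boundary (a := 0) (b := 1)
    (fun t _ => (hφ t).continuousAt.continuousWithinAt)
    (fun t _ => (hφ t).hasDerivWithinAt) (by simp)
    (fun t _ => (hB t).continuousAt.continuousWithinAt)
    (fun t _ => (hB t).hasDerivWithinAt)
    (fun t ht => by
      have h₁ := real_inner_le_norm (gradient f (x + t • v) - gradient f x) v
      have h₂ := hsmooth (x + t • v) x
      rw [add_sub_cancel_left, norm_smul, Real.norm_of_nonneg ht.1] at h₂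
      rw [inner_sub_left] at h₁
      have h₃ := mul_le_mul_of_nonneg_right h₂ (norm_nonneg v)
      linarith)
    (Set.right_mem_Icc.2 zero_le_one)
  simpa using h

end GradientInequalities

open RealInnerProductSpace

/-- If `f : E → ℝ` is differentiable, convex, and `L`-smooth with `L > 0`, and `θ*` is a
minimizer of `f`, then `⟪∇f θ, θ − θ*⟫ ≥ (1/L) ‖∇f θ‖²` for all `θ`. -/
theorem smooth_convex_grad_inner_sub_min {E : Type*} [NormedAddCommGroup E]
    [InnerProductSpace ℝ E] [CompleteSpace E]
    (f : E → ℝ) (L : ℝ) (hL : 0 < L)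
    (hdiff : Differentiable ℝ f)
    (hconv : ConvexOn ℝ Set.univ f)
    (hsmooth : ∀ x y : E, ‖gradient f x - gradient f y‖ ≤ L * ‖x - y‖)
    (θstar : E) (hmin : ∀ θ : E, f θstar ≤ f θ) :
    ∀ θ : E, ⟪gradient f θ, θ - θstar⟫ ≥ (1 / L) * ‖gradient f θ‖ ^ 2 := by
  intro θ
  set g := gradient f θ with hg
  have hstar : gradient f θstar = 0 := by
    have hloc : IsLocalMin f θstar := Filter.Eventually.of_forall hmin
    simp [gradient, hloc.fderiv_eq_zero]
  have hupper := hdiff.le_add_inner_gradient_add_sq hsmooth θstar ((1 / L) • g)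
  have hlower := hconv.add_inner_gradient_le hdiff θ (θstar + (1 / L) • g - θ)
  have hdescent := hdiff.le_add_inner_gradient_add_sq hsmooth θ (-((1 / L) • g))
  have hvalue := hmin (θ + -((1 / L) • g))
  have hinner : ⟪g, θstar + (1 / L) • g - θ⟫ = 1 / L * ‖g‖ ^ 2 - ⟪g, θ - θstar⟫ := by
    simp only [inner_sub_right, inner_add_right, real_inner_smul_right,
      real_inner_self_eq_norm_sq]
    ring
  have hnorm : L / 2 * ‖(1 / L) • g‖ ^ 2 = 1 / L * ‖g‖ ^ 2 / 2 := by
    rw [norm_smul, Real.norm_of_nonneg (by positivity)]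
    field_simp
  rw [hstar, inner_zero_left, hnorm] at hupper
  rw [← hg, hinner, add_sub_cancel] at hlower
  rw [← hg, inner_neg_right, real_inner_smul_right, real_inner_self_eq_norm_sq, norm_neg,
    hnorm] at hdescent
  linarith
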